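/- arXiv:2205.12826 — 2 statements merged into one kernel-verified Lean document; each statement's English description precedes it below -/
import Mathlib

section
/- Let G, H be graphs and r ≥ 2 an integer such that G →ᵣ H. Then there exist constants a = a(G, H, r) and b = b(H, r) (with b depending only on H and r, not on G) such that for every t ∈ ℕ, B(G →ᵣ H; t) ≤ a·bᵗ. -/
/-- `Arrows G H r` : every `r`-colouring of the edges of `G` contains a
monochromatic copy of `H`. -/
def Arrows {α β : Type*} (G : SimpleGraph α) (H : SimpleGraph β) (r : ℕ) : Prop :=
  ∀ c : Sym2 α → Fin r, ∃ f : β → α, Function.Injective f ∧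
    ∃ k : Fin r, ∀ u v : β, H.Adj u v → G.Adj (f u) (f v) ∧ c s(f u, f v) = k

/-- `HasMonoCanonCopy G H n t r c` : the colouring `c` of the edges of the
`n`-blowup `G[n]` contains a monochromatic canonical copy of the `t`-blowup
`H[t]`. -/
def HasMonoCanonCopy {α β : Type*} (G : SimpleGraph α) (H : SimpleGraph β)
    (n t r : ℕ) (c : Sym2 (α × Fin n) → Fin r) : Prop :=
  ∃ f : β → α, Function.Injective f ∧
    ∃ g : β → Fin t → Fin n, (∀ u, Function.Injective (g u)) ∧
      ∃ k : Fin r, ∀ u v : β, H.Adj u v →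
        G.Adj (f u) (f v) ∧ ∀ i j, c s((f u, g u i), (f v, g v j)) = k

/-- The blowup Ramsey number `B(G →ᵣ H; t)`: the least `n` such that every
`r`-colouring of the edges of `G[n]` contains a monochromatic canonical copy
of `H[t]`. -/
noncomputable def blowupRamsey {α β : Type*} (G : SimpleGraph α) (H : SimpleGraph β)
    (r t : ℕ) : ℕ :=
  sInf {n : ℕ | ∀ c : Sym2 (α × Fin n) → Fin r, HasMonoCanonCopy G H n t r c}

open Finset

/-- If a set `M` of transversals of `W 0, …, W (h - 1)` has density at least `1 / q`, then it
contains `t` pairwise disjoint members such that every pair of vertices of these members in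
distinct parts lies in a common member of `M`, provided all parts have exponential size in `t`. -/
theorem exists_disjoint_transversals (h : ℕ) : ∀ q : ℕ, 0 < q → ∃ C : ℕ, 0 < C ∧
    ∀ {V : Type} (t : ℕ) (W : Fin h → Finset V) (M : Finset (Fin h → V)),
      M ⊆ Fintype.piFinset W → (∀ u, C ^ t ≤ #(W u)) → ∏ u, #(W u) ≤ q * #M →
      ∃ g : Fin t → Fin h → V, (∀ i, g i ∈ M) ∧ (∀ u, Function.Injective fun i => g i u) ∧
        ∀ u v, u ≠ v → ∀ i j, ∃ x ∈ M, x u = g i u ∧ x v = g j v := by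
  classical
  induction h with
  | zero =>
    intro q _
    refine ⟨1, one_pos, fun t W M _ _ hM => ?_⟩
    have hpos : 0 < #M := by
      rw [Finset.univ_eq_empty, Finset.prod_empty] at hM
      exact Nat.pos_of_mul_pos_left (lt_of_lt_of_le one_pos hM)
    obtain ⟨x, hx⟩ := Finset.card_pos.1 hpos
    exact ⟨fun _ => x, fun _ => hx, fun u => u.elim0, fun u => u.elim0⟩
  | succ h ih =>
    intro q hq
    obtain ⟨C, hC, ih⟩ := ih (2 * q) (by positivity)
    refine ⟨(max C 4) ^ (4 * q), by positivity, fun {V} t W M hMW hW hM => ?_⟩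
    rcases Nat.eq_zero_or_pos t with rfl | ht
    · exact ⟨fun i => i.elim0, fun i => i.elim0, fun _ i => i.elim0, fun _ _ _ i => i.elim0⟩
    set m := 4 * q * t with hm
    simp only [← pow_mul, ← hm] at hW
    have hW0 : 0 < #(W 0) := lt_of_lt_of_le (by positivity) (hW 0)
    let deg : (Fin h → V) → ℕ := fun y => #{a ∈ W 0 | Fin.cons a y ∈ M}
    let P := Fintype.piFinset fun u : Fin h => W u.succ
    let M' := {y ∈ P | #(W 0) ≤ 2 * q * deg y}
    have hcardM : #M ≤ ∑ y ∈ P, deg y := by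
      rw [Finset.card_eq_sum_card_fiberwise (f := Fin.tail) (t := P)]
      · refine Finset.sum_le_sum fun y _ => ?_
        refine Finset.card_le_card_of_injOn (fun x => x 0) ?_ ?_
        · intro x hx
          simp only [Finset.coe_filter, Set.mem_ofPred_eq] at hx ⊢
          obtain ⟨hx, rfl⟩ := hx
          exact ⟨Fintype.mem_piFinset.1 (hMW hx) 0, by rwa [Fin.cons_self_tail]⟩
        · intro x hx z hz hxz
          simp only [Finset.coe_filter, Set.mem_ofPred_eq] at hx hz hxz
          rw [← Fin.cons_self_tail x, ← Fin.cons_self_tail z, hx.2, hz.2, hxz]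
      · intro x hx
        exact Fintype.mem_piFinset.2 fun u => Fintype.mem_piFinset.1 (hMW hx) u.succ
    have hcardP : #P = ∏ u : Fin h, #(W u.succ) := Fintype.card_piFinset _
    have hM' : ∏ u : Fin h, #(W u.succ) ≤ 2 * q * #M' := by
      rw [Fin.prod_univ_succ, ← hcardP] at hM
      rw [← hcardP]
      have h1 : ∑ y ∈ P, 2 * q * deg y ≤
          ∑ y ∈ P, ((if #(W 0) ≤ 2 * q * deg y then 2 * q * #(W 0) else 0) + #(W 0)) := by
        refine Finset.sum_le_sum fun y _ => ?_
        split_ifs with hy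
        · have : deg y ≤ #(W 0) := Finset.card_filter_le _ _
          nlinarith
        · omega
      rw [← Finset.mul_sum, Finset.sum_add_distrib, ← Finset.sum_filter, Finset.sum_const,
        Finset.sum_const, smul_eq_mul, smul_eq_mul] at h1
      have h2 : 2 * q * #M ≤ #M' * (2 * q * #(W 0)) + #P * #(W 0) :=
        (Nat.mul_le_mul_left _ hcardM).trans h1
      have h3 : #(W 0) * #P ≤ #(W 0) * (2 * q * #M') := by nlinarith
      exact Nat.le_of_mul_le_mul_left h3 hW0
    obtain ⟨g, hgM, hginj, hgpair⟩ := ih m (fun u => W u.succ) M' (Finset.filter_subset _ _)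
      (fun u => (Nat.pow_le_pow_left (le_max_left _ _) _).trans (hW u.succ)) hM'
    let S : V → Finset (Fin m) := fun a => {i | Fin.cons a (g i) ∈ M}
    let good := {a ∈ W 0 | t ≤ #(S a)}
    have hinc : m * #(W 0) ≤ 2 * q * ∑ a ∈ W 0, #(S a) := by
      have h1 : ∑ a ∈ W 0, #(S a) = ∑ i : Fin m, deg (g i) := by
        simp only [S, deg, Finset.card_filter]
        exact Finset.sum_comm
      rw [h1, Finset.mul_sum]
      calc m * #(W 0) = ∑ _i : Fin m, #(W 0) := by simp
        _ ≤ _ := Finset.sum_le_sum fun i _ => (Finset.mem_filter.1 (hgM i)).2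
    have hgood : #(W 0) ≤ 4 * q * #good := by
      have h1 : ∑ a ∈ W 0, #(S a) ≤ ∑ a ∈ W 0, ((if t ≤ #(S a) then m else 0) + t) := by
        refine Finset.sum_le_sum fun a _ => ?_
        split_ifs with ha
        · exact ((Finset.card_le_univ _).trans (by simp)).trans (Nat.le_add_right m t)
        · omega
      rw [Finset.sum_add_distrib, ← Finset.sum_filter, Finset.sum_const, Finset.sum_const,
        smul_eq_mul, smul_eq_mul] at h1
      have h2 : m * #(W 0) ≤ 2 * q * (#good * m + #(W 0) * t) :=
        hinc.trans (Nat.mul_le_mul_left _ h1)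
      have h3 : (2 * q * t) * #(W 0) ≤ (2 * q * t) * (4 * q * #good) := by
        rw [hm] at h2
        nlinarith
      exact Nat.le_of_mul_le_mul_left h3 (by positivity)
    have hcount : 2 ^ m * t ≤ #good := by
      have h1 : 4 * q * (2 ^ m * t) ≤ 4 * q * #good := by
        calc 4 * q * (2 ^ m * t) = m * 2 ^ m := by rw [hm]; ring
          _ ≤ 2 ^ m * 2 ^ m := Nat.mul_le_mul_right _ Nat.lt_two_pow_self.le
          _ = 4 ^ m := by rw [← mul_pow]; norm_num
          _ ≤ max C 4 ^ m := Nat.pow_le_pow_left (le_max_right _ _) _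
          _ ≤ #(W 0) := hW 0
          _ ≤ _ := hgood
      exact Nat.le_of_mul_le_mul_left h1 (by positivity)
    have hsub : ∀ a, ∃ s : Finset (Fin m), a ∈ good → s ⊆ S a ∧ #s = t := by
      intro a
      by_cases ha : a ∈ good
      · obtain ⟨s, hs⟩ := Finset.exists_subset_card_eq (Finset.mem_filter.1 ha).2
        exact ⟨s, fun _ => hs⟩
      · exact ⟨∅, fun h => absurd h ha⟩
    choose s hs using hsub
    obtain ⟨s₀, -, hs₀⟩ := Finset.exists_le_card_fiber_of_mul_le_card_of_maps_to
      (s := good) (t := Finset.univ) (f := s) (n := t) (fun _ _ => Finset.mem_univ _)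
      Finset.univ_nonempty (by simpa using hcount)
    obtain ⟨a₀, ha₀⟩ := Finset.card_pos.1 (lt_of_lt_of_le ht hs₀)
    have hs₀card : #s₀ = t := by
      rw [Finset.mem_filter] at ha₀
      rw [← ha₀.2]
      exact (hs a₀ ha₀.1).2
    let σ := s₀.orderEmbOfFin hs₀card
    obtain ⟨τ⟩ : Nonempty (Fin t ↪ {x ∈ good | s x = s₀}) :=
      Function.Embedding.nonempty_of_card_le (by simpa using hs₀)
    have hmem : ∀ i j, Fin.cons (τ i : V) (g (σ j)) ∈ M := by
      intro i j
      obtain ⟨h1, h2⟩ := Finset.mem_filter.1 (τ i).2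
      have h3 := (hs _ h1).1 (h2.symm ▸ s₀.orderEmbOfFin_mem hs₀card j : σ j ∈ s (τ i))
      exact (Finset.mem_filter.1 h3).2
    refine ⟨fun i => Fin.cons (τ i : V) (g (σ i)), fun i => hmem i i, ?_, ?_⟩
    · intro u
      refine Fin.cases ?_ (fun u => ?_) u
      · exact fun i j hij => τ.injective (Subtype.ext (by simpa using hij))
      · exact fun i j hij => σ.injective (hginj u (by simpa using hij))
    · intro u v huv i j
      induction u using Fin.cases with
      | zero =>
        induction v using Fin.cases with
        | zero => exact absurd rfl huv
        | succ v => exact ⟨_, hmem i j, by simp, by simp⟩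
      | succ u =>
        induction v using Fin.cases with
        | zero => exact ⟨_, hmem j i, by simp, by simp⟩
        | succ v =>
          obtain ⟨y, hy, hyu, hyv⟩ := hgpair u v (fun h => huv (by rw [h])) (σ i) (σ j)
          have hdeg : 0 < deg y := by
            have := (Finset.mem_filter.1 hy).2
            exact Nat.pos_of_mul_pos_left (lt_of_lt_of_le hW0 this)
          obtain ⟨a, ha⟩ := Finset.card_pos.1 hdeg
          exact ⟨_, (Finset.mem_filter.1 ha).2, by simpa using hyu, by simpa using hyv⟩

/-- The number of pairs in `A × B` related by `R`. -/
noncomputable def edgeCount {V : Type} (R : V → V → Prop) (A B : Finset V) : ℝ :=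
  open Classical in ∑ a ∈ A, ∑ b ∈ B, if R a b then 1 else 0

theorem edgeCount_nonneg {V : Type} (R : V → V → Prop) (A B : Finset V) :
    0 ≤ edgeCount R A B := by
  classical
  exact Finset.sum_nonneg fun a _ => Finset.sum_nonneg fun b _ => by split_ifs <;> norm_num

theorem edgeCount_le {V : Type} (R : V → V → Prop) (A B : Finset V) :
    edgeCount R A B ≤ #A * #B := by
  classical
  calc edgeCount R A B ≤ ∑ _a ∈ A, ∑ _b ∈ B, (1 : ℝ) :=
        Finset.sum_le_sum fun a _ => Finset.sum_le_sum fun b _ => by split_ifs <;> norm_num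
    _ = #A * #B := by simp

theorem edgeCount_eq_sum_card {V : Type} (R : V → V → Prop) [∀ a, DecidablePred (R a)]
    (A B : Finset V) : edgeCount R A B = ∑ a ∈ A, (#{b ∈ B | R a b} : ℝ) := by
  classical
  refine Finset.sum_congr rfl fun a _ => ?_
  rw [← Finset.sum_boole]
  congr!

theorem edgeCount_swap {V : Type} (R : V → V → Prop) (A B : Finset V) :
    edgeCount R A B = edgeCount (fun b a => R a b) B A :=
  Finset.sum_comm

theorem edgeCount_sdiff_add {V : Type} [DecidableEq V] (R : V → V → Prop) {A A' B B' : Finset V}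
    (hA : A' ⊆ A) (hB : B' ⊆ B) :
    edgeCount R (A \ A') B + edgeCount R A' (B \ B') + edgeCount R A' B' = edgeCount R A B := by
  classical
  unfold edgeCount
  rw [← Finset.sum_sdiff hA, add_assoc, ← Finset.sum_add_distrib]
  congr 1
  exact Finset.sum_congr rfl fun a _ => Finset.sum_sdiff hB

/-- The relation `R` has nearly constant density `d` between subsets of `A` and `B`, up to an
error `γ * #A * #B` in the number of edges. -/
def IsHomogeneous {V : Type} (γ : ℝ) (R : V → V → Prop) (A B : Finset V) : Prop :=
  ∃ d : ℝ, ∀ A' ⊆ A, ∀ B' ⊆ B, |edgeCount R A' B' - d * (#A' * #B')| ≤ γ * (#A * #B)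

theorem IsHomogeneous.mono {V : Type} {γ δ : ℝ} (hγ : 0 ≤ γ) (hδ : 0 ≤ δ) {R : V → V → Prop}
    {A B A₁ B₁ : Finset V} (h : IsHomogeneous (γ * δ ^ 2) R A B) (hA : A₁ ⊆ A) (hB : B₁ ⊆ B)
    (hA' : δ * #A ≤ #A₁) (hB' : δ * #B ≤ #B₁) : IsHomogeneous γ R A₁ B₁ := by
  obtain ⟨d, hd⟩ := h
  refine ⟨d, fun A' hA₁ B' hB₁ => (hd A' (hA₁.trans hA) B' (hB₁.trans hB)).trans ?_⟩
  calc γ * δ ^ 2 * (#A * #B) = γ * ((δ * #A) * (δ * #B)) := by ring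
    _ ≤ γ * (#A₁ * #B₁) := by gcongr

/-- Every relation is homogeneous between suitable subsets of positive proportion. -/
theorem exists_isHomogeneous {γ : ℝ} (hγ : 0 < γ) : ∃ δ : ℝ, 0 < δ ∧
    ∀ {V : Type} (R : V → V → Prop) (A B : Finset V), A.Nonempty → B.Nonempty →
      ∃ A' ⊆ A, ∃ B' ⊆ B, A'.Nonempty ∧ B'.Nonempty ∧ δ * #A ≤ #A' ∧ δ * #B ≤ #B' ∧
        IsHomogeneous γ R A' B' := by
  classical
  refine ⟨Real.exp (-(2 / γ)), Real.exp_pos _, fun R A B hA hB => ?_⟩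
  let Φ : Finset _ × Finset _ → ℝ := fun p =>
    edgeCount R p.1 p.2 / (#p.1 * #p.2) - γ / 2 * Real.log (#p.1 * #p.2)
  let F := {p ∈ A.powerset ×ˢ B.powerset | p.1.Nonempty ∧ p.2.Nonempty}
  have hF : ∀ p, p ∈ F ↔ (p.1 ⊆ A ∧ p.2 ⊆ B) ∧ p.1.Nonempty ∧ p.2.Nonempty := by
    intro p
    simp [F]
  obtain ⟨⟨A₁, B₁⟩, hp, hmin⟩ := Finset.exists_min_image F Φ
    ⟨(A, B), (hF _).2 ⟨⟨subset_rfl, subset_rfl⟩, hA, hB⟩⟩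
  obtain ⟨⟨hA₁, hB₁⟩, hA₁n, hB₁n⟩ := (hF _).1 hp
  dsimp only at hA₁ hB₁ hA₁n hB₁n
  have hApos : (0 : ℝ) < #A := by exact_mod_cast hA.card_pos
  have hBpos : (0 : ℝ) < #B := by exact_mod_cast hB.card_pos
  have hA₁pos : (0 : ℝ) < #A₁ := by exact_mod_cast hA₁n.card_pos
  have hB₁pos : (0 : ℝ) < #B₁ := by exact_mod_cast hB₁n.card_pos
  have hA₁le : (#A₁ : ℝ) ≤ #A := by exact_mod_cast Finset.card_le_card hA₁
  have hB₁le : (#B₁ : ℝ) ≤ #B := by exact_mod_cast Finset.card_le_card hB₁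
  have hsize : Real.exp (-(2 / γ)) * (#A * #B) ≤ #A₁ * #B₁ := by
    have h1 := hmin (A, B) ((hF _).2 ⟨⟨subset_rfl, subset_rfl⟩, hA, hB⟩)
    have h2 : 0 ≤ edgeCount R A₁ B₁ / (#A₁ * #B₁) :=
      div_nonneg (edgeCount_nonneg _ _ _) (by positivity)
    have h3 : edgeCount R A B / (#A * #B) ≤ 1 :=
      (div_le_one (by positivity)).2 (edgeCount_le _ _ _)
    dsimp only [Φ] at h1
    have h4 : -(2 / γ) + Real.log (#A * #B) ≤ Real.log (#A₁ * #B₁) := by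
      have h5 : γ / 2 * (-(2 / γ) + Real.log (#A * #B)) ≤ γ / 2 * Real.log (#A₁ * #B₁) := by
        have : γ / 2 * -(2 / γ) = -1 := by field_simp
        rw [mul_add, this]
        linarith
      exact le_of_mul_le_mul_left h5 (by positivity)
    have h6 := Real.exp_le_exp.2 h4
    rwa [Real.exp_add, Real.exp_log (by positivity), Real.exp_log (by positivity)] at h6
  refine ⟨A₁, hA₁, B₁, hB₁, hA₁n, hB₁n, ?_, ?_, ?_⟩
  · refine le_of_mul_le_mul_right (a := (#B : ℝ)) ?_ hBpos
    calc _ = Real.exp (-(2 / γ)) * (#A * #B) := by ring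
      _ ≤ #A₁ * #B₁ := hsize
      _ ≤ _ := by gcongr
  · refine le_of_mul_le_mul_left (a := (#A : ℝ)) ?_ hApos
    calc _ = Real.exp (-(2 / γ)) * (#A * #B) := by ring
      _ ≤ #A₁ * #B₁ := hsize
      _ ≤ _ := by gcongr
  · set d := edgeCount R A₁ B₁ / (#A₁ * #B₁) with hd
    have hdN : d * (#A₁ * #B₁) = edgeCount R A₁ B₁ := div_mul_cancel₀ _ (by positivity)
    have lower : ∀ A' ⊆ A₁, ∀ B' ⊆ B₁,
        d * (#A' * #B') - γ / 2 * (#A₁ * #B₁) ≤ edgeCount R A' B' := by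
      intro A' hA' B' hB'
      rcases A'.eq_empty_or_nonempty with rfl | hA'n
      · simp [edgeCount]
        positivity
      rcases B'.eq_empty_or_nonempty with rfl | hB'n
      · simp [edgeCount]
        positivity
      have hA'pos : (0 : ℝ) < #A' := by exact_mod_cast hA'n.card_pos
      have hB'pos : (0 : ℝ) < #B' := by exact_mod_cast hB'n.card_pos
      have h1 := hmin (A', B') ((hF _).2 ⟨⟨hA'.trans hA₁, hB'.trans hB₁⟩, hA'n, hB'n⟩)
      dsimp only [Φ] at h1
      rw [← hd] at h1
      set N : ℝ := #A₁ * #B₁ with hN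
      set N' : ℝ := #A' * #B' with hN'
      have hNpos : 0 < N := by positivity
      have hN'pos : 0 < N' := by positivity
      have h2 := Real.one_sub_inv_le_log_of_pos (div_pos hN'pos hNpos)
      rw [Real.log_div hN'pos.ne' hNpos.ne', inv_div] at h2
      have h3 : d + γ / 2 * (1 - N / N') ≤ edgeCount R A' B' / N' := by
        have := mul_le_mul_of_nonneg_left h2 (by positivity : 0 ≤ γ / 2)
        linarith
      have h4 := mul_le_mul_of_nonneg_right h3 hN'pos.le
      rw [div_mul_cancel₀ _ hN'pos.ne'] at h4
      have h5 : (d + γ / 2 * (1 - N / N')) * N' = d * N' + γ / 2 * N' - γ / 2 * N := by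
        field_simp
        ring
      have h6 : 0 ≤ γ / 2 * N' := by positivity
      linarith
    refine ⟨d, fun A' hA' B' hB' => abs_le.2 ⟨?_, ?_⟩⟩
    · have h1 := lower A' hA' B' hB'
      have : 0 ≤ γ / 2 * (#A₁ * #B₁) := by positivity
      linarith
    · have h1 := lower (A₁ \ A') Finset.sdiff_subset B₁ subset_rfl
      have h2 := lower A' hA' (B₁ \ B') Finset.sdiff_subset
      have h3 := edgeCount_sdiff_add R hA' hB'
      have h4 : (#(A₁ \ A') : ℝ) = #A₁ - #A' := by
        rw [Finset.cast_card_sdiff hA']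
      have h5 : (#(B₁ \ B') : ℝ) = #B₁ - #B' := by
        rw [Finset.cast_card_sdiff hB']
      rw [h4] at h1
      rw [h5] at h2
      linarith

/-- Simultaneous version of `exists_isHomogeneous` for a list of relations between parts. -/
theorem exists_forall_isHomogeneous (ℓ : ℕ) : ∀ γ : ℝ, 0 < γ → ∃ δ : ℝ, 0 < δ ∧
    ∀ {V ι : Type} (L : List (ι × ι × (V → V → Prop))) (W : ι → Finset V), L.length = ℓ →
      (∀ e ∈ L, e.1 ≠ e.2.1) → (∀ i, (W i).Nonempty) →
      ∃ W' : ι → Finset V, (∀ i, W' i ⊆ W i) ∧ (∀ i, (W' i).Nonempty) ∧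
        (∀ i, δ * #(W i) ≤ #(W' i)) ∧
        ∀ e ∈ L, IsHomogeneous γ e.2.2 (W' e.1) (W' e.2.1) := by
  classical
  induction ℓ with
  | zero =>
    intro γ _
    refine ⟨1, one_pos, fun L W hL _ hW => ⟨W, fun _ => subset_rfl, hW, fun i => by simp, ?_⟩⟩
    rw [List.length_eq_zero_iff.1 hL]
    simp
  | succ ℓ ih =>
    intro γ hγ
    obtain ⟨δ, hδ, ih⟩ := ih γ hγ
    obtain ⟨δ', hδ', hom⟩ := exists_isHomogeneous (γ := γ * δ ^ 2) (by positivity)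
    refine ⟨δ * min δ' 1, by positivity, fun {V ι} L W hL hne hW => ?_⟩
    obtain _ | ⟨⟨i, j, R⟩, L⟩ := L
    · simp at hL
    have hij : i ≠ j := hne _ List.mem_cons_self
    obtain ⟨A, hA, B, hB, hAn, hBn, hAs, hBs, hAB⟩ := hom R (W i) (W j) (hW i) (hW j)
    let U : ι → Finset V := fun k => if k = i then A else if k = j then B else W k
    have hUi : U i = A := by simp [U]
    have hUj : U j = B := by simp [U, hij.symm]
    have hU : ∀ k, U k ⊆ W k ∧ (U k).Nonempty ∧ min δ' 1 * #(W k) ≤ #(U k) := by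
      intro k
      by_cases hki : k = i
      · subst hki
        rw [hUi]
        exact ⟨hA, hAn, le_trans (by gcongr; exact min_le_left _ _) hAs⟩
      by_cases hkj : k = j
      · subst hkj
        rw [hUj]
        exact ⟨hB, hBn, le_trans (by gcongr; exact min_le_left _ _) hBs⟩
      have : U k = W k := by simp [U, hki, hkj]
      rw [this]
      exact ⟨subset_rfl, hW k, mul_le_of_le_one_left (by positivity) (min_le_right _ _)⟩
    obtain ⟨W', hW'U, hW'n, hW's, hW'⟩ := ih L U (by simpa using hL)
      (fun e he => hne e (List.mem_cons_of_mem _ he)) fun k => (hU k).2.1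
    refine ⟨W', fun k => (hW'U k).trans (hU k).1, hW'n, fun k => ?_, fun e he => ?_⟩
    · calc δ * min δ' 1 * #(W k) = δ * (min δ' 1 * #(W k)) := by ring
        _ ≤ δ * #(U k) := by gcongr; exact (hU k).2.2
        _ ≤ _ := hW's k
    · rcases List.mem_cons.1 he with rfl | he
      · have hi := hW's i
        have hj := hW's j
        have hi' := hW'U i
        have hj' := hW'U j
        rw [hUi] at hi hi'
        rw [hUj] at hj hj'
        exact hAB.mono hγ.le hδ.le hi' hj' hi hj
      · exact hW' e he

/-- Counting lemma: if every pair of parts has density at least `θ` between subsets, up to a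
sufficiently small error, then a positive proportion of transversals respects all relations. -/
theorem exists_le_card_transversals {θ : ℝ} (hθ : 0 < θ) (h : ℕ) : ∃ γ : ℝ, 0 < γ ∧ ∃ c : ℝ,
    0 < c ∧ ∀ {V : Type} (X : Fin h → Finset V) (R : Fin h → Fin h → V → V → Prop),
      (∀ u, (X u).Nonempty) →
      (∀ u v, u < v → ∀ A ⊆ X u, ∀ B ⊆ X v,
        θ * (#A * #B) - γ * (#(X u) * #(X v)) ≤ edgeCount (R u v) A B) →
      ∃ M ⊆ Fintype.piFinset X, (∀ x ∈ M, ∀ u v, u < v → R u v (x u) (x v)) ∧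
        c * ∏ u, (#(X u) : ℝ) ≤ #M := by
  classical
  induction h with
  | zero =>
    refine ⟨1, one_pos, 1, one_pos, fun X R _ _ => ⟨Fintype.piFinset X, subset_rfl, ?_, ?_⟩⟩
    · exact fun _ _ u => u.elim0
    · simp
  | succ h ih =>
    obtain ⟨γ', hγ', c', hc', ih⟩ := ih
    have hγ : 0 < min (γ' * (θ / 2) ^ 2) (θ / (4 * (h + 1))) := by positivity
    refine ⟨_, hγ, c' * (θ / 2) ^ h / 2, by positivity, fun {V} X R hX hR => ?_⟩
    set γ := min (γ' * (θ / 2) ^ 2) (θ / (4 * (h + 1)))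
    have hγ₁ : γ ≤ γ' * (θ / 2) ^ 2 := min_le_left _ _
    have hγ₂ : γ ≤ θ / (4 * (h + 1)) := min_le_right _ _
    have hXpos : ∀ u, (0 : ℝ) < #(X u) := fun u => by exact_mod_cast (hX u).card_pos
    let N : V → Fin h → Finset V := fun a v => {b ∈ X v.succ | R 0 v.succ a b}
    let T := {a ∈ X 0 | ∀ v, θ / 2 * #(X v.succ) ≤ #(N a v)}
    have hbad : ∀ v : Fin h, (#{a ∈ X 0 | ¬ θ / 2 * #(X v.succ) ≤ #(N a v)} : ℝ) ≤
        #(X 0) / (2 * (h + 1)) := by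
      intro v
      set Z := {a ∈ X 0 | ¬ θ / 2 * #(X v.succ) ≤ #(N a v)}
      have h1 := hR 0 v.succ (Fin.succ_pos v) Z (Finset.filter_subset _ _) _ subset_rfl
      have h2 : edgeCount (R 0 v.succ) Z (X v.succ) ≤ #Z * (θ / 2 * #(X v.succ)) := by
        rw [edgeCount_eq_sum_card, ← nsmul_eq_mul]
        exact Finset.sum_le_card_nsmul _ _ _ fun a ha => (not_le.1 (Finset.mem_filter.1 ha).2).le
      have h3 : (θ / 2 * #Z) * #(X v.succ) ≤ (γ * #(X 0)) * #(X v.succ) := by linarith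
      have h4 := le_of_mul_le_mul_right h3 (hXpos v.succ)
      have h5 : γ * #(X 0) ≤ θ / (4 * (h + 1)) * #(X 0) := by gcongr
      have h6 : θ / 2 * #Z ≤ θ / 2 * (#(X 0) / (2 * (h + 1))) := by
        refine (h4.trans h5).trans_eq ?_
        field_simp
        norm_num
      exact le_of_mul_le_mul_left h6 (by positivity)
    have hT : (#(X 0) : ℝ) / 2 ≤ #T := by
      have h1 : X 0 \ T ⊆
          Finset.univ.biUnion fun v : Fin h => {a ∈ X 0 | ¬ θ / 2 * #(X v.succ) ≤ #(N a v)} := by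
        intro a ha
        simp only [T, Finset.mem_sdiff, Finset.mem_filter, not_and, not_forall] at ha
        obtain ⟨v, hv⟩ := ha.2 ha.1
        exact Finset.mem_biUnion.2 ⟨v, Finset.mem_univ _, Finset.mem_filter.2 ⟨ha.1, hv⟩⟩
      have h2 : (#(X 0 \ T) : ℝ) ≤ h * (#(X 0) / (2 * (h + 1))) := by
        calc (#(X 0 \ T) : ℝ) ≤ ∑ v : Fin h,
              (#{a ∈ X 0 | ¬ θ / 2 * #(X v.succ) ≤ #(N a v)} : ℝ) := by
              exact_mod_cast (Finset.card_le_card h1).trans Finset.card_biUnion_le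
          _ ≤ ∑ _v : Fin h, (#(X 0) : ℝ) / (2 * (h + 1)) := Finset.sum_le_sum fun v _ => hbad v
          _ = _ := by simp
      rw [Finset.cast_card_sdiff (Finset.filter_subset _ _)] at h2
      have h3 : (h : ℝ) * (#(X 0) / (2 * (h + 1))) ≤ #(X 0) / 2 := by
        rw [mul_div_assoc', div_le_div_iff₀ (by positivity) (by positivity)]
        nlinarith [hXpos 0]
      linarith
    have hext : ∀ a, ∃ M : Finset (Fin h → V), a ∈ T → M ⊆ Fintype.piFinset (N a) ∧
        (∀ x ∈ M, ∀ u v, u < v → R u.succ v.succ (x u) (x v)) ∧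
        c' * ∏ v, (#(N a v) : ℝ) ≤ #M := by
      intro a
      by_cases ha : a ∈ T
      swap
      · exact ⟨∅, fun h => absurd h ha⟩
      have hN : ∀ v, θ / 2 * #(X v.succ) ≤ #(N a v) := (Finset.mem_filter.1 ha).2
      have hNn : ∀ v, (N a v).Nonempty := by
        intro v
        have h1 : (0 : ℝ) < #(N a v) := lt_of_lt_of_le (by have := hXpos v.succ; positivity) (hN v)
        exact Finset.card_pos.1 (by exact_mod_cast h1)
      have hNR : ∀ u v : Fin h, u < v → ∀ A ⊆ N a u, ∀ B ⊆ N a v,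
          θ * (#A * #B) - γ' * (#(N a u) * #(N a v)) ≤ edgeCount (R u.succ v.succ) A B := by
        intro u v huv A hA B hB
        refine le_trans ?_ (hR u.succ v.succ (Fin.succ_lt_succ_iff.2 huv) A
          (hA.trans (Finset.filter_subset _ _)) B (hB.trans (Finset.filter_subset _ _)))
        have h1 : γ * (#(X u.succ) * #(X v.succ)) ≤ γ' * (#(N a u) * #(N a v)) := by
          calc γ * (#(X u.succ) * #(X v.succ))
              ≤ γ' * (θ / 2) ^ 2 * (#(X u.succ) * #(X v.succ)) := by gcongr
            _ = γ' * ((θ / 2 * #(X u.succ)) * (θ / 2 * #(X v.succ))) := by ring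
            _ ≤ _ := by gcongr <;> apply hN
        linarith
      obtain ⟨M, hM⟩ := ih (N a) (fun u v => R u.succ v.succ) hNn hNR
      exact ⟨M, fun _ => hM⟩
    choose M hM using hext
    refine ⟨(T.sigma M).image fun p => Fin.cons p.1 p.2, ?_, ?_, ?_⟩
    · intro x hx
      obtain ⟨⟨a, y⟩, hp, rfl⟩ := Finset.mem_image.1 hx
      obtain ⟨ha, hy⟩ := Finset.mem_sigma.1 hp
      refine Fintype.mem_piFinset.2 (Fin.cases (Finset.mem_filter.1 ha).1 fun v => ?_)
      have := Fintype.mem_piFinset.1 ((hM a ha).1 hy) v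
      exact (Finset.mem_filter.1 this).1
    · intro x hx u v huv
      obtain ⟨⟨a, y⟩, hp, rfl⟩ := Finset.mem_image.1 hx
      obtain ⟨ha, hy⟩ := Finset.mem_sigma.1 hp
      dsimp only at ha hy
      induction v using Fin.cases with
      | zero => exact absurd huv (Fin.not_lt_zero u)
      | succ v =>
        induction u using Fin.cases with
        | zero =>
          have := Fintype.mem_piFinset.1 ((hM a ha).1 hy) v
          simpa using (Finset.mem_filter.1 this).2
        | succ u => simpa using (hM a ha).2.1 y hy u v (Fin.succ_lt_succ_iff.1 huv)
    · rw [Finset.card_image_of_injective, Finset.card_sigma, Nat.cast_sum, Fin.prod_univ_succ]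
      · calc c' * (θ / 2) ^ h / 2 * (#(X 0) * ∏ v : Fin h, (#(X v.succ) : ℝ))
            = #(X 0) / 2 * (c' * ((θ / 2) ^ h * ∏ v : Fin h, (#(X v.succ) : ℝ))) := by ring
          _ ≤ #T * (c' * ((θ / 2) ^ h * ∏ v : Fin h, (#(X v.succ) : ℝ))) := by gcongr
          _ = #T • (c' * ∏ v : Fin h, (θ / 2 * (#(X v.succ) : ℝ))) := by
            rw [Finset.prod_mul_distrib, Finset.prod_const, Finset.card_univ, Fintype.card_fin,
              nsmul_eq_mul]
          _ ≤ ∑ a ∈ T, (#(M a) : ℝ) := by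
            refine Finset.card_nsmul_le_sum _ _ _ fun a ha => le_trans ?_ (hM a ha).2.2
            gcongr with v
            exact (Finset.mem_filter.1 ha).2 v
      · rintro ⟨a, y⟩ ⟨b, z⟩ hab
        obtain ⟨rfl, rfl⟩ := Fin.cons_injective2 hab
        rfl

/-- The Fox–Luo–Wigderson theorem: for every graph `H` and `r ≥ 2` there is a
constant `b = b(H, r)` (independent of `G`) such that for every graph `G`
with `G →ᵣ H` there is a constant `a = a(G, H, r)` with
`B(G →ᵣ H; t) ≤ a·bᵗ` for every `t`. -/
theorem fox_luo_wigderson_bound (pH : ℕ) (H : SimpleGraph (Fin pH)) (r : ℕ)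
    (hr : 2 ≤ r) :
    ∃ b : ℕ, ∀ (pG : ℕ) (G : SimpleGraph (Fin pG)), Arrows G H r →
      ∃ a : ℕ, ∀ t : ℕ, blowupRamsey G H r t ≤ a * b ^ t := by
  classical
  have hr0 : (0 : ℝ) < r := by positivity
  obtain ⟨γ, hγ, κ, hκ, hcount⟩ := exists_le_card_transversals (θ := 1 / r) (by positivity) pH
  obtain ⟨q, hq⟩ := exists_nat_gt (1 / κ)
  have hq0 : (0 : ℝ) < q := lt_trans (by positivity) hq
  obtain ⟨b, hb, hdisj⟩ := exists_disjoint_transversals pH q (by exact_mod_cast hq0)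
  refine ⟨b, fun pG G hG => ?_⟩
  let I := (Finset.univ : Finset (Fin pG × Fin pG × Fin r)).filter fun e => e.1 ≠ e.2.1
  obtain ⟨δ, hδ, hhom⟩ := exists_forall_isHomogeneous I.toList.length (γ / 2) (by positivity)
  obtain ⟨a, ha⟩ := exists_nat_gt (1 / δ)
  have ha0 : (0 : ℝ) < a := lt_trans (by positivity) ha
  refine ⟨a, fun t => ?_⟩
  have ha0' : 0 < a := by exact_mod_cast ha0
  have hn : 0 < a * b ^ t := by positivity
  obtain ⟨n, hn_def⟩ : ∃ n, n = a * b ^ t := ⟨_, rfl⟩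
  rw [← hn_def] at hn ⊢
  refine Nat.sInf_le fun c => ?_
  have : NeZero n := ⟨hn.ne'⟩
  let E : Fin pG → Fin pG → Fin r → Fin n → Fin n → Prop := fun i j k x y =>
    c s((i, x), (j, y)) = k
  obtain ⟨W, -, hWn, hWs, hW⟩ := hhom (I.toList.map fun e => (e.1, e.2.1, E e.1 e.2.1 e.2.2))
    (fun _ => Finset.univ) (by simp) (by
      intro e he
      obtain ⟨e', he', rfl⟩ := List.mem_map.1 he
      exact (Finset.mem_filter.1 (Finset.mem_toList.1 he')).2) (fun _ => Finset.univ_nonempty)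
  have hWcard : ∀ i, b ^ t ≤ #(W i) := by
    intro i
    have h1 := hWs i
    have h0 : (n : ℝ) = a * b ^ t := by exact_mod_cast hn_def
    rw [Finset.card_univ, Fintype.card_fin, h0] at h1
    have h2 : 1 ≤ δ * a := by
      rw [div_lt_iff₀ hδ] at ha
      linarith
    have h3 : (b : ℝ) ^ t ≤ #(W i) := by
      refine le_trans ?_ h1
      rw [← mul_assoc]
      exact le_mul_of_one_le_left (by positivity) h2
    exact_mod_cast h3
  have hdense : ∀ i j, ∃ k, i ≠ j → ∀ A ⊆ W i, ∀ B ⊆ W j,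
      1 / r * (#A * #B) - γ * (#(W i) * #(W j)) ≤ edgeCount (E i j k) A B := by
    intro i j
    by_cases hij : i = j
    · exact ⟨⟨0, by omega⟩, fun h => absurd hij h⟩
    have hsum : ∑ k, edgeCount (E i j k) (W i) (W j) = #(W i) * #(W j) := by
      unfold edgeCount
      rw [Finset.sum_comm, Finset.sum_congr rfl fun _ _ => Finset.sum_comm]
      refine (Finset.sum_congr rfl fun x _ => Finset.sum_congr rfl fun y _ =>
        Finset.sum_eq_single (c s((i, x), (j, y))) (fun k _ hk => if_neg hk.symm)
          fun h => absurd (Finset.mem_univ _) h).trans ?_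
      simp
    obtain ⟨k, -, hk⟩ := Finset.exists_le_of_sum_le (s := Finset.univ)
      (f := fun _ : Fin r => 1 / (r : ℝ) * (#(W i) * #(W j)))
      (g := fun k => edgeCount (E i j k) (W i) (W j)) ⟨⟨0, by omega⟩, Finset.mem_univ _⟩ (by
        rw [hsum, Finset.sum_const, Finset.card_univ, Fintype.card_fin, nsmul_eq_mul,
          ← mul_assoc, mul_one_div_cancel hr0.ne', one_mul])
    refine ⟨k, fun _ A hA B hB => ?_⟩
    obtain ⟨d, hd⟩ := hW (i, j, E i j k) (List.mem_map.2 ⟨(i, j, k),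
      Finset.mem_toList.2 (Finset.mem_filter.2 ⟨Finset.mem_univ _, hij⟩), rfl⟩)
    have h1 := (abs_le.1 (hd _ subset_rfl _ subset_rfl)).2
    have h2 := (abs_le.1 (hd A hA B hB)).1
    dsimp only at h1 h2 hk
    have hi : (0 : ℝ) < #(W i) := by exact_mod_cast (hWn i).card_pos
    have hj : (0 : ℝ) < #(W j) := by exact_mod_cast (hWn j).card_pos
    have h3 : 1 / r - d ≤ γ / 2 := by
      refine le_of_mul_le_mul_right (a := (#(W i) * #(W j) : ℝ)) ?_ (by positivity)
      linarith
    have h4 : (1 / r - d) * (#A * #B) ≤ γ / 2 * (#(W i) * #(W j)) := by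
      refine (mul_le_mul_of_nonneg_right h3 (by positivity)).trans ?_
      gcongr
    linarith
  have hcol : ∀ e : Sym2 (Fin pG), ∃ k, ∀ i j, i ≠ j → s(i, j) = e → ∀ A ⊆ W i, ∀ B ⊆ W j,
      1 / r * (#A * #B) - γ * (#(W i) * #(W j)) ≤ edgeCount (E i j k) A B := by
    intro e
    induction e using Sym2.ind with
    | _ i j =>
      obtain ⟨k, hk⟩ := hdense i j
      refine ⟨k, fun i' j' hne he A hA B hB => ?_⟩
      rcases Sym2.eq_iff.1 he with ⟨rfl, rfl⟩ | ⟨rfl, rfl⟩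
      · exact hk hne A hA B hB
      · have h1 := hk hne.symm B hB A hA
        rw [edgeCount_swap] at h1
        have h2 : (fun x y => E j' i' k y x) = E i' j' k := by
          funext x y
          simp only [E, Sym2.eq_swap]
        rw [h2] at h1
        linarith
  choose χ hχ using hcol
  obtain ⟨f, hf, k, hk⟩ := hG χ
  obtain ⟨M, hMX, hM, hMcard⟩ := hcount (fun u => W (f u))
    (fun u v x y => H.Adj u v → E (f u) (f v) k x y) (fun u => hWn _) (by
      intro u v huv A hA B hB
      by_cases hadj : H.Adj u v
      · simp only [hadj, true_imp_iff]
        rw [← (hk u v hadj).2]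
        exact hχ _ _ _ (fun h => huv.ne (hf h)) rfl A hA B hB
      · have h1 : edgeCount (fun x y => H.Adj u v → E (f u) (f v) k x y) A B = #A * #B := by
          simp [edgeCount, hadj]
        rw [h1]
        have h2 : 1 / (r : ℝ) ≤ 1 := by
          rw [div_le_one hr0]
          exact_mod_cast (by omega : 1 ≤ r)
        have h3 : 1 / (r : ℝ) * (#A * #B) ≤ #A * #B := mul_le_of_le_one_left (by positivity) h2
        have h4 : 0 ≤ γ * (#(W (f u)) * #(W (f v))) := by positivity
        linarith)
  obtain ⟨g, hgM, hginj, hgpair⟩ := hdisj t (fun u => W (f u)) M hMX (fun u => hWcard _) (by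
    have h1 : 1 ≤ q * κ := by
      rw [div_lt_iff₀ hκ] at hq
      exact hq.le
    have h2 : (∏ u, (#(W (f u)) : ℝ)) ≤ q * #M := by
      calc (∏ u, (#(W (f u)) : ℝ)) ≤ q * κ * ∏ u, (#(W (f u)) : ℝ) :=
            le_mul_of_one_le_left (by positivity) h1
        _ = q * (κ * ∏ u, (#(W (f u)) : ℝ)) := by ring
        _ ≤ _ := by gcongr
    exact_mod_cast h2)
  refine ⟨f, hf, fun u i => g i u, hginj, k, fun u v huv => ⟨(hk u v huv).1, fun i j => ?_⟩⟩
  obtain ⟨x, hx, hxu, hxv⟩ := hgpair u v huv.ne i j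
  dsimp only
  rw [← hxu, ← hxv]
  rcases lt_or_gt_of_ne huv.ne with hlt | hlt
  · exact hM x hx u v hlt huv
  · rw [Sym2.eq_swap]
    exact hM x hx v u hlt huv.symm
end

section
/- For every t ∈ ℕ, there exists a constant C(t) > 0 and n₀ ∈ ℕ such that for every n ≥ n₀, every 2-colouring of the edges of the complete graph K_n in which each of the two colours appears on at least C(t)·n^{2−1/t} edges contains a (2,t)-unavoidable coloured K_{2t}. -/
/-- `ContainsUnavoidablePair t n c` : the `2`-edge-coloured complete graph on
`Fin n` with colouring `c` contains a `(2,t)`-unavoidable coloured `K_{2t}`: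
two disjoint `t`-sets `A`, `B`, with all edges inside `A` of colour `k₁`, all
edges inside `B` of colour `k₂`, all edges between `A` and `B` of colour `k₃`,
and not all of `k₁, k₂, k₃` equal (this is exactly a `t`-blowup of a
`2`-minimal graph, equivalently one of the colours induces on `A ∪ B` either a
clique on `t` vertices or two vertex-disjoint cliques on `t` vertices). -/
def ContainsUnavoidablePair (t n : ℕ) (c : Sym2 (Fin n) → Fin 2) : Prop :=
  ∃ (A B : Finset (Fin n)) (k₁ k₂ k₃ : Fin 2),
    Disjoint A B ∧ A.card = t ∧ B.card = t ∧ ¬(k₁ = k₂ ∧ k₂ = k₃) ∧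
    (∀ a ∈ A, ∀ b ∈ A, a ≠ b → c s(a, b) = k₁) ∧
    (∀ a ∈ B, ∀ b ∈ B, a ≠ b → c s(a, b) = k₂) ∧
    (∀ a ∈ A, ∀ b ∈ B, c s(a, b) = k₃)

/-- Ramsey's theorem for graphs: every large enough vertex set contains a clique on `p` vertices
or an independent set on `q` vertices. -/
theorem exists_ramsey_bound (p q : ℕ) :
    ∃ N : ℕ, ∀ {V : Type*} (G : SimpleGraph V) (S : Finset V), N ≤ S.card →
      (∃ A ⊆ S, A.card = p ∧ G.IsClique A) ∨ (∃ A ⊆ S, A.card = q ∧ G.IsIndepSet A) := by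
  classical
  induction p generalizing q with
  | zero => exact ⟨0, fun G S _ => Or.inl ⟨∅, by simp, by simp, by simp⟩⟩
  | succ p ihp =>
    induction q with
    | zero => exact ⟨0, fun G S _ => Or.inr ⟨∅, by simp, by simp, by simp⟩⟩
    | succ q ihq =>
      obtain ⟨M, hM⟩ := ihp (q + 1)
      obtain ⟨N, hN⟩ := ihq
      refine ⟨M + N + 1, fun {V} G S hS => ?_⟩
      obtain ⟨v, hv⟩ : S.Nonempty := Finset.card_pos.1 (by omega)
      have hsplit := Finset.card_filter_add_card_filter_not (s := S.erase v) (G.Adj v)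
      rw [Finset.card_erase_of_mem hv] at hsplit
      by_cases hA : M ≤ ((S.erase v).filter (G.Adj v)).card
      · rcases hM G _ hA with ⟨A, hAS, hAc, hcl⟩ | ⟨A, hAS, hAc, hind⟩
        · have hadj : ∀ w ∈ A, G.Adj v w := fun w hw => (Finset.mem_filter.1 (hAS hw)).2
          refine Or.inl ⟨insert v A, ?_, ?_, ?_⟩
          · intro w hw
            rcases Finset.mem_insert.1 hw with rfl | hw
            · exact hv
            · exact Finset.mem_of_mem_erase (Finset.mem_filter.1 (hAS hw)).1
          · rw [Finset.card_insert_of_notMem (fun h => G.irrefl (hadj v h)), hAc]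
          · rw [Finset.coe_insert, SimpleGraph.isClique_insert]
            exact ⟨hcl, fun w hw _ => hadj w hw⟩
        · exact Or.inr ⟨A, fun w hw => Finset.mem_of_mem_erase (Finset.mem_filter.1 (hAS hw)).1,
            hAc, hind⟩
      · have hB : N ≤ ((S.erase v).filter (fun w => ¬ G.Adj v w)).card := by omega
        rcases hN G _ hB with ⟨A, hAS, hAc, hcl⟩ | ⟨A, hAS, hAc, hind⟩
        · exact Or.inl ⟨A, fun w hw => Finset.mem_of_mem_erase (Finset.mem_filter.1 (hAS hw)).1,
            hAc, hcl⟩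
        · have hadj : ∀ w ∈ A, ¬ G.Adj v w := fun w hw => (Finset.mem_filter.1 (hAS hw)).2
          refine Or.inr ⟨insert v A, ?_, ?_, ?_⟩
          · intro w hw
            rcases Finset.mem_insert.1 hw with rfl | hw
            · exact hv
            · exact Finset.mem_of_mem_erase (Finset.mem_filter.1 (hAS hw)).1
          · rw [Finset.card_insert_of_notMem, hAc]
            intro h
            exact Finset.ne_of_mem_erase (Finset.mem_filter.1 (hAS h)).1 rfl
          · rw [← SimpleGraph.isClique_compl] at hind ⊢
            rw [Finset.coe_insert, SimpleGraph.isClique_insert]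
            exact ⟨hind, fun w hw hne => (G.compl_adj v w).2 ⟨hne, hadj w hw⟩⟩

/-- Dependent random choice: a graph with large degree sum contains a set `U` of `a` vertices
all of whose `(s + 1)`-subsets have at least `b` common neighbours. -/
theorem exists_subset_forall_le_card_common_neighbors {V : Type*} [Fintype V] [Nonempty V]
    (G : SimpleGraph V) [DecidableRel G.Adj] (s a b : ℕ)
    (h : Fintype.card V ^ s * (Fintype.card V ^ (s + 1) * (a + b) ^ (s + 1)) ≤
      (∑ v, G.degree v) ^ (s + 1)) :
    ∃ U : Finset V, a ≤ U.card ∧ ∀ S ⊆ U, S.card = s + 1 →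
      ∃ W : Finset V, b ≤ W.card ∧ ∀ v ∈ S, ∀ w ∈ W, G.Adj v w := by
  classical
  have hn : 0 < Fintype.card V := Fintype.card_pos
  let nbr : (Fin (s + 1) → V) → Finset V := fun T => Finset.univ.filter fun v => ∀ i, G.Adj v (T i)
  let com : Finset V → Finset V := fun S => Finset.univ.filter fun w => ∀ v ∈ S, G.Adj v w
  let bad : Finset (Finset V) :=
    (Finset.univ.powersetCard (s + 1)).filter fun S => (com S).card < b
  have hnbr : Fintype.card V ^ (s + 1) * (a + b) ^ (s + 1) ≤ ∑ T, (nbr T).card := by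
    have hsum : ∑ T, (nbr T).card = ∑ v, G.degree v ^ (s + 1) := by
      have := Finset.sum_card_bipartiteAbove_eq_sum_card_bipartiteBelow
        (s := (Finset.univ : Finset (Fin (s + 1) → V))) (t := (Finset.univ : Finset V))
        (fun T v => ∀ i, G.Adj v (T i))
      refine this.trans (Finset.sum_congr rfl fun v _ => ?_)
      rw [← G.card_neighborFinset_eq_degree, ← Fintype.card_piFinset_const]
      congr 1
      ext T
      simp [Finset.bipartiteBelow]
    rw [hsum]
    refine Nat.le_of_mul_le_mul_left (h.trans ?_) (pow_pos hn s)
    exact pow_sum_le_card_mul_sum_pow (fun _ _ => Nat.zero_le _) s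
  have hbad : ∑ T, (bad.filter fun S => S ⊆ nbr T).card ≤
      Fintype.card V ^ (s + 1) * b ^ (s + 1) := by
    have := Finset.sum_card_bipartiteAbove_eq_sum_card_bipartiteBelow
      (s := (Finset.univ : Finset (Fin (s + 1) → V))) (t := bad) (fun T S => S ⊆ nbr T)
    refine this.le.trans ((Finset.sum_le_card_nsmul _ _ (b ^ (s + 1)) fun S hS => ?_).trans ?_)
    · have hS' : (com S).card < b := (Finset.mem_filter.1 hS).2
      refine le_trans ?_ (Nat.pow_le_pow_left hS'.le (s + 1))
      rw [← Fintype.card_piFinset_const]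
      refine Finset.card_le_card fun T hT => ?_
      have hT' : S ⊆ nbr T := (Finset.mem_filter.1 hT).2
      refine Fintype.mem_piFinset.2 fun i => Finset.mem_filter.2 ⟨Finset.mem_univ _, fun v hv => ?_⟩
      exact (Finset.mem_filter.1 (hT' hv)).2 i
    · rw [smul_eq_mul]
      refine Nat.mul_le_mul_right _ ((Finset.card_filter_le _ _).trans ?_)
      rw [Finset.card_powersetCard, Finset.card_univ]
      exact Nat.choose_le_pow _ _
  obtain ⟨T, -, hT⟩ : ∃ T ∈ (Finset.univ : Finset (Fin (s + 1) → V)),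
      a + (bad.filter fun S => S ⊆ nbr T).card ≤ (nbr T).card := by
    refine Finset.exists_le_of_sum_le Finset.univ_nonempty ?_
    rw [Finset.sum_add_distrib]
    simp only [Finset.sum_const, Finset.card_univ, Fintype.card_fun, Fintype.card_fin, smul_eq_mul]
    refine le_trans ?_ hnbr
    refine (Nat.add_le_add_left hbad _).trans ?_
    rw [← Nat.mul_add]
    refine Nat.mul_le_mul_left _ (le_trans ?_
      (pow_add_pow_le (Nat.zero_le a) (Nat.zero_le b) s.succ_ne_zero))
    exact Nat.add_le_add_right (Nat.le_self_pow s.succ_ne_zero a) _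
  let pick : Finset V → V := fun S => if hS : S.Nonempty then hS.choose else Classical.arbitrary V
  refine ⟨nbr T \ (bad.filter fun S => S ⊆ nbr T).image pick, ?_, fun S hS hSc => ?_⟩
  · have h₁ := Finset.le_card_sdiff ((bad.filter fun S => S ⊆ nbr T).image pick) (nbr T)
    have h₂ := Finset.card_image_le (s := bad.filter fun S => S ⊆ nbr T) (f := pick)
    omega
  · by_contra! hlt
    have hne : S.Nonempty := Finset.card_pos.1 (by omega)
    have hmem : pick S ∈ S := by
      simp only [pick, dif_pos hne]
      exact hne.choose_spec
    refine (Finset.mem_sdiff.1 (hS hmem)).2 (Finset.mem_image_of_mem pick ?_)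
    refine Finset.mem_filter.2 ⟨Finset.mem_filter.2 ⟨?_, ?_⟩, ?_⟩
    · exact Finset.mem_powersetCard.2 ⟨Finset.subset_univ _, hSc⟩
    · by_contra! hle
      obtain ⟨v, hv, w, hw, hvw⟩ := hlt (com S) hle
      exact hvw ((Finset.mem_filter.1 hw).2 v hv)
    · exact hS.trans Finset.sdiff_subset

/-- Bipartite Ramsey: for disjoint vertex sets `R` and `B`, with `2 * t ≤ R.card` and `B` large
compared to `R`, there are `t`-subsets of `R` and `B` between which all or no edges are present. -/
theorem exists_subset_forall_iff_of_card_le {V : Type*} (r : V → V → Prop) (t : ℕ)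
    (R B : Finset V) (hR : 2 * t ≤ R.card) (hB : 2 ^ R.card * t ≤ B.card) :
    ∃ X ⊆ R, ∃ Y ⊆ B, X.card = t ∧ Y.card = t ∧
      ((∀ x ∈ X, ∀ y ∈ Y, r x y) ∨ (∀ x ∈ X, ∀ y ∈ Y, ¬ r x y)) := by
  classical
  obtain ⟨P, hP, hfib⟩ := Finset.exists_le_card_fiber_of_mul_le_card_of_maps_to
    (s := B) (t := R.powerset) (f := fun y => R.filter fun x => r x y) (n := t)
    (fun y _ => Finset.mem_powerset.2 (Finset.filter_subset _ _))
    ⟨∅, by simp⟩ (by rwa [Finset.card_powerset])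
  obtain ⟨Y, hYs, hYc⟩ := Finset.exists_subset_card_eq hfib
  have hY : ∀ y ∈ Y, ∀ x ∈ R, (r x y ↔ x ∈ P) := by
    intro y hy x hx
    rw [← (Finset.mem_filter.1 (hYs hy)).2, Finset.mem_filter, and_iff_right hx]
  have hYB : Y ⊆ B := hYs.trans (Finset.filter_subset _ _)
  have hPR := Finset.mem_powerset.1 hP
  have hcard := Finset.card_sdiff_add_card_eq_card hPR
  by_cases hPt : t ≤ P.card
  · obtain ⟨X, hX, hXc⟩ := Finset.exists_subset_card_eq hPt
    exact ⟨X, hX.trans hPR, Y, hYB, hXc, hYc,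
      Or.inl fun x hx y hy => (hY y hy x (hPR (hX hx))).2 (hX hx)⟩
  · obtain ⟨X, hX, hXc⟩ := Finset.exists_subset_card_eq (show t ≤ (R \ P).card by omega)
    refine ⟨X, hX.trans Finset.sdiff_subset, Y, hYB, hXc, hYc, Or.inr fun x hx y hy hr => ?_⟩
    have := Finset.mem_sdiff.1 (hX hx)
    exact this.2 ((hY y hy x this.1).1 hr)

/-- The graph of the edges of colour `k`. -/
def colourGraph {V : Type*} (c : Sym2 V → Fin 2) (k : Fin 2) : SimpleGraph V where
  Adj a b := a ≠ b ∧ c s(a, b) = k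
  symm := ⟨fun a b h => ⟨h.1.symm, Sym2.eq_swap (a := a) (b := b) ▸ h.2⟩⟩
  loopless := ⟨fun _ h => h.1 rfl⟩

theorem colourGraph_edgeSet {V : Type*} (c : Sym2 V → Fin 2) (k : Fin 2) :
    (colourGraph c k).edgeSet = {e : Sym2 V | ¬ e.IsDiag ∧ c e = k} := by
  ext e
  induction e with
  | _ a b => simp [colourGraph]

/-- The hypothesis on the number of edges, turned into the power inequality for the degree sum
used by dependent random choice. -/
theorem pow_le_sum_degree_pow {V : Type*} [Fintype V] [Nonempty V] (G : SimpleGraph V)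
    [DecidableRel G.Adj] (s C : ℕ)
    (h : (C : ℝ) * (Fintype.card V : ℝ) ^ ((2 : ℝ) - 1 / ((s + 1 : ℕ) : ℝ)) ≤ G.edgeSet.ncard) :
    Fintype.card V ^ s * (Fintype.card V ^ (s + 1) * C ^ (s + 1)) ≤
      (∑ v, G.degree v) ^ (s + 1) := by
  classical
  set n := Fintype.card V
  have hncard : G.edgeSet.ncard ≤ ∑ v, G.degree v := by
    rw [G.sum_degrees_eq_twice_card_edges, ← G.coe_edgeFinset, Set.ncard_coe_finset]
    omega
  have hpow : ((C : ℝ) * (n : ℝ) ^ ((2 : ℝ) - 1 / ((s + 1 : ℕ) : ℝ))) ^ (s + 1) =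
      (n : ℝ) ^ s * ((n : ℝ) ^ (s + 1) * (C : ℝ) ^ (s + 1)) := by
    have hexp : ((2 : ℝ) - 1 / ((s + 1 : ℕ) : ℝ)) * ((s + 1 : ℕ) : ℝ) =
        ((s + (s + 1) : ℕ) : ℝ) := by
      push_cast
      field_simp
      ring
    rw [mul_pow, ← Real.rpow_natCast ((n : ℝ) ^ _) (s + 1), ← Real.rpow_mul (Nat.cast_nonneg n),
      hexp, Real.rpow_natCast, pow_add]
    ring
  have hle := pow_le_pow_left₀ (by positivity) (h.trans (Nat.cast_le.2 hncard)) (s + 1)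
  rw [hpow] at hle
  exact_mod_cast hle

/-- Enough edges of colour `k` force either an unavoidable pattern or a clique of colour `k` on `K`
vertices. -/
theorem exists_containsUnavoidablePair_or_isClique (s K : ℕ) :
    ∃ C : ℕ, ∀ (n : ℕ) [NeZero n] (c : Sym2 (Fin n) → Fin 2) (k : Fin 2),
      (C : ℝ) * (n : ℝ) ^ ((2 : ℝ) - 1 / ((s + 1 : ℕ) : ℝ)) ≤
          ({e : Sym2 (Fin n) | ¬ e.IsDiag ∧ c e = k}.ncard : ℝ) →
        ContainsUnavoidablePair (s + 1) n c ∨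
          ∃ A : Finset (Fin n), A.card = K ∧ (colourGraph c k).IsClique A := by
  classical
  obtain ⟨a, ha⟩ := exists_ramsey_bound K (s + 1)
  obtain ⟨b, hb⟩ := exists_ramsey_bound (s + 1) (s + 1)
  refine ⟨a + b, fun n _ c k h => ?_⟩
  rw [← colourGraph_edgeSet] at h
  obtain ⟨U, hUa, hU⟩ := exists_subset_forall_le_card_common_neighbors (colourGraph c k) s a b
    (pow_le_sum_degree_pow _ s (a + b) (by rwa [Fintype.card_fin]))
  rcases ha (colourGraph c k) U hUa with ⟨A, -, hA, hcl⟩ | ⟨A, hAU, hA, hind⟩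
  · exact Or.inr ⟨A, hA, hcl⟩
  left
  have hAcol : ∀ x ∈ A, ∀ y ∈ A, x ≠ y → c s(x, y) = 1 - k := by
    intro x hx y hy hne
    have : c s(x, y) ≠ k := fun hk => hind hx hy hne ⟨hne, hk⟩
    omega
  have hk : 1 - k ≠ k := by omega
  obtain ⟨W, hbW, hW⟩ := hU A hAU hA
  have hdisj : ∀ B ⊆ W, Disjoint A B := fun B hB =>
    Finset.disjoint_left.2 fun x hx hxB => (hW x hx x (hB hxB)).ne rfl
  rcases hb (colourGraph c k) W hbW with ⟨B, hBW, hB, hBcl⟩ | ⟨B, hBW, hB, hBind⟩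
  · exact ⟨A, B, 1 - k, k, k, hdisj B hBW, hA, hB, fun h => hk h.1, hAcol,
      fun x hx y hy hne => (hBcl hx hy hne).2, fun x hx y hy => (hW x hx y (hBW hy)).2⟩
  · refine ⟨A, B, 1 - k, 1 - k, k, hdisj B hBW, hA, hB, fun h => hk h.2, hAcol,
      fun x hx y hy hne => ?_, fun x hx y hy => (hW x hx y (hBW hy)).2⟩
    have : c s(x, y) ≠ k := fun hk => hBind hx hy hne ⟨hne, hk⟩
    omega

/-- A large clique in each of the two colours yields an unavoidable pattern. -/
theorem containsUnavoidablePair_of_isClique {t n : ℕ} {c : Sym2 (Fin n) → Fin 2}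
    {R B : Finset (Fin n)} (hRc : R.card = 2 ^ (2 * t) * t + 2 * t)
    (hBc : B.card = 2 ^ (2 * t) * t + 2 * t) (hR : (colourGraph c 0).IsClique R)
    (hB : (colourGraph c 1).IsClique B) : ContainsUnavoidablePair t n c := by
  classical
  obtain ⟨R', hR's, hR'⟩ := Finset.exists_subset_card_eq (show 2 * t ≤ R.card by omega)
  have hle := Finset.le_card_sdiff R' B
  obtain ⟨X, hX, Y, hY, hXc, hYc, hXY⟩ := exists_subset_forall_iff_of_card_le
    (fun x y => c s(x, y) = 0) t R' (B \ R') hR'.ge (by rw [hR']; omega)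
  have hdisj : Disjoint X Y := Finset.disjoint_of_subset_left hX
    (Finset.disjoint_of_subset_right hY Finset.disjoint_sdiff)
  have hXcol : ∀ a ∈ X, ∀ b ∈ X, a ≠ b → c s(a, b) = 0 := fun a ha b hb hne =>
    (hR (hR's (hX ha)) (hR's (hX hb)) hne).2
  have hYcol : ∀ a ∈ Y, ∀ b ∈ Y, a ≠ b → c s(a, b) = 1 := fun a ha b hb hne =>
    (hB (Finset.sdiff_subset (hY ha)) (Finset.sdiff_subset (hY hb)) hne).2
  rcases hXY with h | h
  · exact ⟨X, Y, 0, 1, 0, hdisj, hXc, hYc, by decide, hXcol, hYcol, h⟩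
  · exact ⟨X, Y, 0, 1, 1, hdisj, hXc, hYc, by decide, hXcol, hYcol,
      fun a ha b hb => by have := h a ha b hb; omega⟩

/-- For every `t` there are a constant `C(t) > 0` and `n₀` such that for every
`n ≥ n₀`, every `2`-colouring of the edges of `K_n` in which each colour
appears on at least `C(t)·n^{2-1/t}` edges contains a `(2,t)`-unavoidable
coloured `K_{2t}`. -/
theorem unavoidable_two_colours_polynomial (t : ℕ) :
    ∃ C : ℝ, 0 < C ∧ ∃ n₀ : ℕ, ∀ n : ℕ, n₀ ≤ n →
      ∀ c : Sym2 (Fin n) → Fin 2,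
        (∀ k : Fin 2,
          C * (n : ℝ) ^ ((2 : ℝ) - 1 / (t : ℝ)) ≤
            ({e : Sym2 (Fin n) | ¬ e.IsDiag ∧ c e = k}.ncard : ℝ)) →
        ContainsUnavoidablePair t n c := by
  rcases t with _ | s
  · exact ⟨1, one_pos, 0, fun n _ c _ => ⟨∅, ∅, 0, 1, 0, by simp⟩⟩
  obtain ⟨C, hC⟩ := exists_containsUnavoidablePair_or_isClique s
    (2 ^ (2 * (s + 1)) * (s + 1) + 2 * (s + 1))
  refine ⟨C + 1, by positivity, 1, fun n hn c h => ?_⟩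
  have : NeZero n := ⟨by omega⟩
  have hedges : ∀ k : Fin 2, (C : ℝ) * (n : ℝ) ^ ((2 : ℝ) - 1 / ((s + 1 : ℕ) : ℝ)) ≤
      ({e : Sym2 (Fin n) | ¬ e.IsDiag ∧ c e = k}.ncard : ℝ) := fun k =>
    le_trans (mul_le_mul_of_nonneg_right (by linarith) (by positivity)) (h k)
  rcases hC n c 0 (hedges 0) with hp | ⟨R, hRc, hR⟩
  · exact hp
  rcases hC n c 1 (hedges 1) with hp | ⟨B, hBc, hB⟩
  · exact hp
  exact containsUnavoidablePair_of_isClique hRc hBc hR hB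
end
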